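/- arXiv:0812.3181 — 2 statements merged into one kernel-verified Lean document; each statement's English description precedes it below -/
import Mathlib

section
/- Let n ≥ 4 (Morawetz estimate for the wave equation). There is a constant C (depending only on n) such that for all f, g ∈ 𝒮(ℝⁿ), the solution u of the wave equation ∂_t²u = Σ_j ∂²_{x_j}u with u(0,·) = f and ∂_t u(0,·) = g, given by û(t,ξ) = cos(t|ξ|) f̂(ξ) + (sin(t|ξ|)/|ξ|) ĝ(ξ), satisfies the global spacetime estimate ∫_ℝ ∫_{ℝⁿ} |u(t,x)|² / |x|³ dx dt ≤ C ( ‖f‖²_{H¹} + ‖g‖²_{L²} ). -/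
open MeasureTheory
open scoped RealInnerProductSpace

/-- The Fourier transform `û(ξ) = (2π)^{-n/2} ∫ u(x) e^{-i x·ξ} dx`. -/
noncomputable def fourierT {n : ℕ} (u : EuclideanSpace ℝ (Fin n) → ℂ)
    (ξ : EuclideanSpace ℝ (Fin n)) : ℂ :=
  ((2 * Real.pi) ^ (-(n : ℝ) / 2) : ℝ) *
    ∫ x, Complex.exp (-Complex.I * (⟪x, ξ⟫ : ℝ)) * u x

/-- The squared Sobolev norm `‖u‖²_{H^s} = ∫ (1+|ξ|²)^s |û(ξ)|² dξ`. -/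
noncomputable def sobolevNormSq {n : ℕ} (s : ℝ) (u : EuclideanSpace ℝ (Fin n) → ℂ) : ℝ :=
  ∫ ξ, (1 + ‖ξ‖ ^ 2) ^ s * ‖fourierT u ξ‖ ^ 2

/-- The solution of the wave equation `∂_t²u = Σ_j ∂²_{x_j}u` with Cauchy data
`u(0,·) = f`, `∂_t u(0,·) = g`, defined via the Fourier multiplier formula
`û(t,ξ) = cos(t|ξ|) f̂(ξ) + (sin(t|ξ|)/|ξ|) ĝ(ξ)`. -/
noncomputable def waveSol {n : ℕ} (f g : SchwartzMap (EuclideanSpace ℝ (Fin n)) ℂ)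
    (t : ℝ) (x : EuclideanSpace ℝ (Fin n)) : ℂ :=
  ((2 * Real.pi) ^ (-(n : ℝ) / 2) : ℝ) *
    ∫ ξ, Complex.exp (Complex.I * (⟪x, ξ⟫ : ℝ)) *
      (((Real.cos (t * ‖ξ‖) : ℝ) : ℂ) * fourierT (⇑f) ξ
        + ((Real.sin (t * ‖ξ‖) / ‖ξ‖ : ℝ) : ℂ) * fourierT (⇑g) ξ)

section

open Measure
open scoped ENNReal

theorem lintegral_eq_lintegral_sphere_prod {E : Type*} [NormedAddCommGroup E] [NormedSpace ℝ E]
    [FiniteDimensional ℝ E] [Nontrivial E] [MeasurableSpace E] [BorelSpace E]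
    (μ : Measure E) [μ.IsAddHaarMeasure] {F : E → ℝ≥0∞} (hF : Measurable F) :
    ∫⁻ x, F x ∂μ = ∫⁻ ω : Metric.sphere (0 : E) 1, ∫⁻ r in Set.Ioi (0 : ℝ),
      ENNReal.ofReal (r ^ (Module.finrank ℝ E - 1)) * F (r • (ω : E)) ∂volume ∂μ.toSphere := by
  have hm : Measurable fun p : Metric.sphere (0 : E) 1 × Set.Ioi (0 : ℝ) ↦
      F ((p.2 : ℝ) • (p.1 : E)) := by fun_prop
  have h := μ.measurePreserving_homeomorphUnitSphereProd.lintegral_comp_emb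
    (Homeomorph.measurableEmbedding _) (fun p ↦ F ((p.2 : ℝ) • (p.1 : E)))
  have h1 : ∀ x : ({0}ᶜ : Set E), F (((homeomorphUnitSphereProd E x).2 : ℝ) •
      ((homeomorphUnitSphereProd E x).1 : E)) = F x := by
    intro x
    have : ‖(x : E)‖ ≠ 0 := norm_ne_zero_iff.2 x.2
    congr 1
    simp [smul_smul, this]
  simp only [h1] at h
  rw [lintegral_subtype_comap (measurableSet_singleton _).compl, restrict_compl_singleton] at h
  rw [h, lintegral_prod _ hm.aemeasurable]
  refine lintegral_congr fun ω ↦ ?_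
  have hω : Measurable fun r : Set.Ioi (0 : ℝ) ↦ F ((r : ℝ) • (ω : E)) := by fun_prop
  rw [volumeIoiPow, lintegral_withDensity_eq_lintegral_mul _ (by fun_prop) hω]
  exact lintegral_subtype_comap measurableSet_Ioi
    (fun r : ℝ ↦ ENNReal.ofReal (r ^ (Module.finrank ℝ E - 1)) * F (r • (ω : E)))

theorem lintegral_radial_mul_homogeneous {E : Type*} [NormedAddCommGroup E] [NormedSpace ℝ E]
    [FiniteDimensional ℝ E] [Nontrivial E] [MeasurableSpace E] [BorelSpace E]
    (μ : Measure E) [μ.IsAddHaarMeasure] {P : E → ℝ≥0∞} (hP : Measurable P) (k : ℝ → ℝ≥0∞)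
    (hk : Measurable k)
    (hom : ∀ r : ℝ, 0 < r → ∀ x, P (r • x) = k r * P x)
    {ψ : ℝ → ℝ≥0∞} (hψ : Measurable ψ) :
    ∫⁻ x, ψ ‖x‖ * P x ∂μ = (∫⁻ ω : Metric.sphere (0 : E) 1, P ω ∂μ.toSphere) * ∫⁻ r in Set.Ioi (0 : ℝ),
      ENNReal.ofReal (r ^ (Module.finrank ℝ E - 1)) * k r * ψ r := by
  rw [lintegral_eq_lintegral_sphere_prod μ (by fun_prop), ← lintegral_mul_const _ (by fun_prop)]
  refine lintegral_congr fun ω ↦ ?_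
  rw [← lintegral_const_mul _ (by fun_prop)]
  refine setLIntegral_congr_fun measurableSet_Ioi fun r hr ↦ ?_
  have hr' : (0 : ℝ) < r := hr
  have : ‖r • (ω : E)‖ = r := by simp [norm_smul, abs_of_pos hr']
  simp only [this, hom r hr']
  ring

/-- A product of negative powers of all coordinates but one. -/
noncomputable def coordWeight {n : ℕ} (i₀ : Fin n) (α : ℝ) (x : EuclideanSpace ℝ (Fin n)) : ℝ≥0∞ :=
  ∏ i ∈ Finset.univ.erase i₀, ‖x i‖ₑ ^ (-α)

theorem measurable_coordWeight {n : ℕ} (i₀ : Fin n) (α : ℝ) : Measurable (coordWeight i₀ α) := by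
  unfold coordWeight
  fun_prop

theorem coordWeight_smul {n : ℕ} (i₀ : Fin n) (α : ℝ) (r : ℝ)
    (x : EuclideanSpace ℝ (Fin n)) :
    coordWeight i₀ α (r • x) = (‖r‖ₑ ^ (-α)) ^ (n - 1) * coordWeight i₀ α x := by
  simp only [coordWeight, PiLp.smul_apply, smul_eq_mul, enorm_mul]
  simp_rw [ENNReal.mul_rpow_of_ne_top enorm_ne_top enorm_ne_top]
  rw [Finset.prod_mul_distrib, Finset.prod_const, Finset.card_erase_of_mem (Finset.mem_univ _)]
  simp

theorem integrable_abs_rpow_mul_exp_neg_sq {s : ℝ} (hs : -1 < s) :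
    Integrable fun y : ℝ ↦ |y| ^ s * Real.exp (-y ^ 2) := by
  have h := (integrable_rpow_mul_exp_neg_mul_sq one_pos hs).integrableOn (s := Set.Ioi 0)
  have h1 : IntegrableOn (fun y : ℝ ↦ |y| ^ s * Real.exp (-y ^ 2)) (Set.Ioi 0) := by
    refine h.congr_fun (fun y hy ↦ ?_) measurableSet_Ioi
    simp [abs_of_pos (show (0 : ℝ) < y from hy)]
  have h2 : IntegrableOn (fun y : ℝ ↦ |y| ^ s * Real.exp (-y ^ 2)) (Set.Iio 0) := by
    have := h1.comp_neg
    simpa using this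
  rw [← integrableOn_univ, ← Set.Iio_union_Ici (a := (0 : ℝ))]
  exact h2.union ((integrableOn_Ici_iff_integrableOn_Ioi).2 h1)

theorem lintegral_gaussian_mul_coordWeight_lt_top {n : ℕ} (i₀ : Fin n) {α : ℝ} (hα : α < 1) :
    ∫⁻ x : EuclideanSpace ℝ (Fin n), ENNReal.ofReal (Real.exp (-‖x‖ ^ 2)) * coordWeight i₀ α x
      < ∞ := by
  let G : Fin n → ℝ → ℝ := fun i y ↦
    if i = i₀ then Real.exp (-y ^ 2) else |y| ^ (-α) * Real.exp (-y ^ 2)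
  have hG : ∀ i, Integrable (G i) := by
    intro i
    by_cases h : i = i₀
    · simpa [G, h] using integrable_exp_neg_mul_sq one_pos
    · simpa [G, h] using integrable_abs_rpow_mul_exp_neg_sq (s := -α) (by linarith)
  have hint : Integrable (fun x : Fin n → ℝ ↦ ∏ i, G i (x i)) := Integrable.fintype_prod hG
  have hpos : ∀ i y, 0 ≤ G i y := by
    intro i y
    simp only [G]
    split_ifs <;> positivity
  rw [← (PiLp.volume_preserving_toLp (Fin n)).lintegral_comp_emb
    (MeasurableEquiv.toLp 2 _).measurableEmbedding]
  refine lt_of_eq_of_lt (lintegral_congr_ae ?_) hint.lintegral_lt_top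
  have hne : ∀ᵐ x : Fin n → ℝ, ∀ i, x i ≠ 0 := by
    rw [ae_all_iff]
    intro i
    have : ∀ᵐ y : ℝ, y ≠ 0 := by simp [ae_iff]
    exact (quasiMeasurePreserving_eval (fun _ : Fin n ↦ (volume : Measure ℝ)) i).ae this
  filter_upwards [hne] with x hx
  rw [ENNReal.ofReal_prod_of_nonneg fun i _ ↦ hpos i _,
    ← Finset.mul_prod_erase _ _ (Finset.mem_univ i₀)]
  have h1 : ∀ i ∈ Finset.univ.erase i₀, ENNReal.ofReal (G i (x i)) =
      ‖x i‖ₑ ^ (-α) * ENNReal.ofReal (Real.exp (-x i ^ 2)) := by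
    intro i hi
    simp only [G, (Finset.mem_erase.1 hi).1, if_false]
    rw [ENNReal.ofReal_mul (by positivity), ← ENNReal.ofReal_rpow_of_pos (abs_pos.2 (hx i)),
      Real.enorm_eq_ofReal_abs]
  rw [Finset.prod_congr rfl h1, Finset.prod_mul_distrib,
    ← ENNReal.ofReal_prod_of_nonneg fun i _ ↦ (Real.exp_pos _).le, ← Real.exp_sum, mul_left_comm,
    ← ENNReal.ofReal_mul (hpos _ _), mul_comm]
  congr 2
  simp only [G, if_true]
  rw [← Real.exp_add, EuclideanSpace.norm_sq_eq, Finset.add_sum_erase _ (fun i ↦ -x i ^ 2)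
    (Finset.mem_univ i₀)]
  simp

theorem exists_lintegral_radial_mul_coordWeight {n : ℕ} (hn : 4 ≤ n) (i₀ : Fin n) :
    ∃ M : ℝ≥0∞, M ≠ ∞ ∧ ∀ ψ : ℝ → ℝ≥0∞, Measurable ψ →
      ∫⁻ x : EuclideanSpace ℝ (Fin n), ψ ‖x‖ * coordWeight i₀ (((n : ℝ) - 3) / (n - 1)) x =
        M * ∫⁻ r in Set.Ioi (0 : ℝ), ENNReal.ofReal (r ^ 2) * ψ r := by
  have : Nonempty (Fin n) := ⟨i₀⟩
  have hn' : (4 : ℝ) ≤ n := by exact_mod_cast hn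
  set α : ℝ := ((n : ℝ) - 3) / (n - 1) with hα
  have hα1 : α < 1 := by
    rw [hα, div_lt_one (by linarith)]
    linarith
  set M := ∫⁻ ω : Metric.sphere (0 : EuclideanSpace ℝ (Fin n)) 1, coordWeight i₀ α ω
    ∂(volume : Measure (EuclideanSpace ℝ (Fin n))).toSphere
  have key : ∀ ψ : ℝ → ℝ≥0∞, Measurable ψ →
      ∫⁻ x : EuclideanSpace ℝ (Fin n), ψ ‖x‖ * coordWeight i₀ α x =
        M * ∫⁻ r in Set.Ioi (0 : ℝ), ENNReal.ofReal (r ^ 2) * ψ r := by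
    intro ψ hψ
    rw [lintegral_radial_mul_homogeneous volume (measurable_coordWeight i₀ α)
      (fun r ↦ (‖r‖ₑ ^ (-α)) ^ (n - 1)) (by fun_prop)
      (fun r _ x ↦ coordWeight_smul i₀ α r x) hψ]
    congr 1
    refine setLIntegral_congr_fun measurableSet_Ioi fun r hr ↦ ?_
    have hr' : (0 : ℝ) < r := hr
    simp only [finrank_euclideanSpace, Fintype.card_fin]
    congr 1
    rw [Real.enorm_eq_ofReal_abs, abs_of_pos hr', ENNReal.ofReal_rpow_of_pos hr',
      ← ENNReal.ofReal_pow (by positivity), ← ENNReal.ofReal_mul (by positivity)]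
    congr 1
    rw [← Real.rpow_natCast r, ← Real.rpow_natCast (r ^ (-α)), ← Real.rpow_mul hr'.le,
      ← Real.rpow_add hr', ← Real.rpow_natCast r]
    congr 1
    rw [Nat.cast_sub (by omega), hα]
    have : (n : ℝ) - 1 ≠ 0 := by linarith
    field_simp
    push_cast
    ring
  refine ⟨M, ?_, key⟩
  have h1 := key (fun r ↦ ENNReal.ofReal (Real.exp (-r ^ 2))) (by fun_prop)
  have h2 := lintegral_gaussian_mul_coordWeight_lt_top i₀ hα1
  rw [h1] at h2
  intro hM
  rw [hM, ENNReal.top_mul] at h2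
  · exact lt_irrefl _ h2
  · have hm : Measurable fun r : ℝ ↦ ENNReal.ofReal (r ^ 2) * ENNReal.ofReal (Real.exp (-r ^ 2)) := by
      fun_prop
    refine ((setLIntegral_pos_iff hm).2 ?_).ne'
    rw [Set.inter_eq_right.2]
    · simp
    · intro r hr
      have hr' : (0 : ℝ) < r := hr
      simp only [Function.mem_support]
      positivity

theorem exists_orthonormalBasis_eq_smul {n : ℕ} (i₀ : Fin n) (ξ : EuclideanSpace ℝ (Fin n)) :
    ∃ b : OrthonormalBasis (Fin n) ℝ (EuclideanSpace ℝ (Fin n)), ∀ i ≠ i₀, b.repr ξ i = 0 := by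
  by_cases hξ : ξ = 0
  · exact ⟨EuclideanSpace.basisFun _ _, by simp [hξ]⟩
  have hξ' : ‖ξ‖ ≠ 0 := norm_ne_zero_iff.2 hξ
  obtain ⟨b, hb⟩ := Orthonormal.exists_orthonormalBasis_extension_of_card_eq (𝕜 := ℝ)
    (E := EuclideanSpace ℝ (Fin n)) (ι := Fin n) (by simp)
    (v := fun _ ↦ ‖ξ‖⁻¹ • ξ) (s := {i₀}) (by
      refine ⟨fun _ ↦ by simp [norm_smul, hξ'], fun i j hij ↦ ?_⟩
      exact absurd (Subsingleton.elim i j) hij)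
  refine ⟨b, fun i hi ↦ ?_⟩
  have h1 : ξ = ‖ξ‖ • b i₀ := by
    rw [hb i₀ rfl, smul_smul, mul_inv_cancel₀ hξ', one_smul]
  rw [h1]
  simp [hi]

theorem enorm_sub_rpow_le_coordWeight {n : ℕ} (hn : 4 ≤ n) (i₀ : Fin n)
    (b : OrthonormalBasis (Fin n) ℝ (EuclideanSpace ℝ (Fin n))) {ξ : EuclideanSpace ℝ (Fin n)}
    (hξ : ∀ i ≠ i₀, b.repr ξ i = 0) (η : EuclideanSpace ℝ (Fin n)) :
    ‖ξ - η‖ₑ ^ (-((n : ℝ) - 3)) ≤ coordWeight i₀ (((n : ℝ) - 3) / (n - 1)) (b.repr η) := by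
  have hn' : (4 : ℝ) ≤ n := by exact_mod_cast hn
  have h1 : (n : ℝ) - 1 ≠ 0 := by linarith
  have h2 : ‖ξ - η‖ₑ ^ (-((n : ℝ) - 3)) =
      ∏ _i ∈ Finset.univ.erase i₀, ‖ξ - η‖ₑ ^ (-(((n : ℝ) - 3) / (n - 1))) := by
    rw [Finset.prod_const, Finset.card_erase_of_mem (Finset.mem_univ _), ← ENNReal.rpow_natCast,
      ← ENNReal.rpow_mul]
    congr 1
    simp only [Finset.card_univ, Fintype.card_fin]
    rw [Nat.cast_sub (by omega)]
    field_simp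
    simp
  rw [h2, coordWeight]
  refine Finset.prod_le_prod' fun i hi ↦ ?_
  rw [ENNReal.rpow_neg, ENNReal.rpow_neg, ENNReal.inv_le_inv]
  refine ENNReal.rpow_le_rpow ?_ (div_nonneg (by linarith) (by linarith))
  have h3 : ‖b.repr (ξ - η) i‖ ≤ ‖b.repr (ξ - η)‖ := PiLp.norm_apply_le _ i
  rw [map_sub, PiLp.sub_apply, hξ i (Finset.mem_erase.1 hi).1, zero_sub, norm_neg,
    ← map_sub, LinearIsometryEquiv.norm_map] at h3
  exact enorm_le_iff_norm_le.2 h3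

/-- Schur-type bound for the kernel `|η|⁻² |ξ - η|^{3-n}` against radial densities. -/
theorem exists_lintegral_radial_mul_enorm_sub_rpow_le {n : ℕ} (hn : 4 ≤ n) :
    ∃ M : ℝ≥0∞, M ≠ ∞ ∧ ∀ (Φ : ℝ → ℝ≥0∞), Measurable Φ → ∀ ξ : EuclideanSpace ℝ (Fin n),
      ∫⁻ η : EuclideanSpace ℝ (Fin n), (‖η‖ₑ ^ 2)⁻¹ * (‖ξ - η‖ₑ ^ (-((n : ℝ) - 3)) * Φ ‖η‖) ≤
        M * ∫⁻ r, Φ r := by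
  let i₀ : Fin n := ⟨0, by omega⟩
  obtain ⟨M, hM, h⟩ := exists_lintegral_radial_mul_coordWeight hn i₀
  refine ⟨M, hM, fun Φ hΦ ξ ↦ ?_⟩
  obtain ⟨b, hb⟩ := exists_orthonormalBasis_eq_smul i₀ ξ
  set ψ : ℝ → ℝ≥0∞ := fun r ↦ (‖r‖ₑ ^ 2)⁻¹ * Φ r
  have hψ : Measurable ψ := by fun_prop
  calc _ ≤ ∫⁻ η, ψ ‖b.repr η‖ * coordWeight i₀ (((n : ℝ) - 3) / (n - 1)) (b.repr η) := by
        refine lintegral_mono fun η ↦ ?_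
        simp only [ψ, LinearIsometryEquiv.norm_map, enorm_norm]
        rw [mul_comm (‖ξ - η‖ₑ ^ _), ← mul_assoc]
        gcongr
        exact enorm_sub_rpow_le_coordWeight hn i₀ b hb η
    _ = ∫⁻ η, ψ ‖η‖ * coordWeight i₀ (((n : ℝ) - 3) / (n - 1)) η :=
        b.repr.measurePreserving.lintegral_comp_emb b.repr.toHomeomorph.measurableEmbedding
          (fun η ↦ ψ ‖η‖ * coordWeight i₀ (((n : ℝ) - 3) / (n - 1)) η)
    _ = M * ∫⁻ r in Set.Ioi (0 : ℝ), ENNReal.ofReal (r ^ 2) * ψ r := h ψ hψ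
    _ ≤ M * ∫⁻ r, Φ r := by
        refine mul_le_mul_right ?_ M
        refine le_trans (le_of_eq ?_) (setLIntegral_le_lintegral (Set.Ioi 0) Φ)
        refine setLIntegral_congr_fun measurableSet_Ioi fun r hr ↦ ?_
        have hr' : (0 : ℝ) < r := hr
        simp only [ψ]
        rw [Real.enorm_eq_ofReal_abs, abs_of_pos hr', ← ENNReal.ofReal_pow hr'.le, ← mul_assoc,
          ENNReal.mul_inv_cancel (by simp; positivity) ENNReal.ofReal_ne_top, one_mul]

theorem exists_lintegral_gaussian_scales_le {n : ℕ} (hn : 4 ≤ n) :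
    ∃ C : ℝ≥0∞, C ≠ ∞ ∧ ∀ v : EuclideanSpace ℝ (Fin n),
      ∫⁻ τ in Set.Ioi (0 : ℝ), ENNReal.ofReal (τ ^ (-(5 / 2) : ℝ)) *
        ENNReal.ofReal ((Real.pi * τ) ^ ((n : ℝ) / 2) * Real.exp (-(τ * ‖v‖ ^ 2 / 4))) ≤
      C * ‖v‖ₑ ^ (-((n : ℝ) - 3)) := by
  have hn' : (4 : ℝ) ≤ n := by exact_mod_cast hn
  set a : ℝ := ((n : ℝ) - 3) / 2 with ha
  have ha0 : 0 < a := by rw [ha]; linarith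
  set c : ℝ := Real.pi ^ ((n : ℝ) / 2) * (4 ^ a * Real.Gamma a) with hc
  have hc0 : 0 < c := by have := Real.Gamma_pos_of_pos ha0; positivity
  refine ⟨ENNReal.ofReal c, ENNReal.ofReal_ne_top, fun v ↦ ?_⟩
  by_cases hv : v = 0
  · have : ‖v‖ₑ ^ (-((n : ℝ) - 3)) = ∞ := by
      rw [hv, enorm_zero, ENNReal.zero_rpow_of_neg (by linarith)]
    rw [this, ENNReal.mul_top (by simpa using hc0)]
    exact le_top
  have hv' : 0 < ‖v‖ := norm_pos_iff.2 hv
  have h1 : ∀ τ ∈ Set.Ioi (0 : ℝ), ENNReal.ofReal (τ ^ (-(5 / 2) : ℝ)) *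
        ENNReal.ofReal ((Real.pi * τ) ^ ((n : ℝ) / 2) * Real.exp (-(τ * ‖v‖ ^ 2 / 4))) =
      ENNReal.ofReal (Real.pi ^ ((n : ℝ) / 2) *
        (τ ^ (a - 1) * Real.exp (-(‖v‖ ^ 2 / 4 * τ)))) := by
    intro τ hτ
    have hτ' : (0 : ℝ) < τ := hτ
    rw [← ENNReal.ofReal_mul (by positivity), Real.mul_rpow Real.pi_pos.le hτ'.le]
    congr 1
    have : τ ^ (a - 1) = τ ^ (-(5 / 2) : ℝ) * τ ^ ((n : ℝ) / 2) := by
      rw [← Real.rpow_add hτ', ha]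
      congr 1
      ring
    rw [this, show ‖v‖ ^ 2 / 4 * τ = τ * ‖v‖ ^ 2 / 4 by ring]
    ring
  rw [setLIntegral_congr_fun measurableSet_Ioi h1]
  have hr : 0 < ‖v‖ ^ 2 / 4 := by positivity
  have hI := Real.integral_rpow_mul_exp_neg_mul_Ioi ha0 hr
  have hG := Real.Gamma_pos_of_pos ha0
  have hint : IntegrableOn (fun τ : ℝ ↦ τ ^ (a - 1) * Real.exp (-(‖v‖ ^ 2 / 4 * τ)))
      (Set.Ioi 0) := by
    by_contra hcon
    rw [integral_undef hcon] at hI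
    have : 0 < (1 / (‖v‖ ^ 2 / 4)) ^ a * Real.Gamma a := by positivity
    linarith
  rw [← ofReal_integral_eq_lintegral_ofReal (hint.const_mul _), integral_const_mul, hI]
  · rw [← ofReal_norm, ENNReal.ofReal_rpow_of_pos hv', ← ENNReal.ofReal_mul hc0.le]
    refine le_of_eq (congrArg _ ?_)
    have : (1 / (‖v‖ ^ 2 / 4)) ^ a = 4 ^ a * ‖v‖ ^ (-((n : ℝ) - 3)) := by
      rw [one_div_div, Real.div_rpow (by positivity) (by positivity), ← Real.rpow_natCast ‖v‖,
        ← Real.rpow_mul hv'.le, Real.rpow_neg hv'.le, div_eq_mul_inv]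
      congr 3
      rw [ha]
      push_cast
      ring
    rw [this, hc]
    ring
  · filter_upwards [ae_restrict_mem measurableSet_Ioi] with τ hτ
    have hτ' : (0 : ℝ) < τ := hτ
    positivity

theorem ofReal_inv_pow_three_le {a : ℝ} (ha : 0 < a) :
    ENNReal.ofReal ((a ^ 3)⁻¹) ≤ ENNReal.ofReal (2 ^ (5 / 2 : ℝ) * Real.exp 1) *
      ∫⁻ τ in Set.Ioi (0 : ℝ), ENNReal.ofReal (τ ^ (-(5 / 2) : ℝ)) *
        ENNReal.ofReal (Real.exp (-(a ^ 2 / τ))) := by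
  have h1 : ENNReal.ofReal ((2 * a ^ 2) ^ (-(5 / 2) : ℝ) * Real.exp (-1)) *
      volume (Set.Ioc (a ^ 2) (2 * a ^ 2)) ≤
      ∫⁻ τ in Set.Ioi (0 : ℝ), ENNReal.ofReal (τ ^ (-(5 / 2) : ℝ)) *
        ENNReal.ofReal (Real.exp (-(a ^ 2 / τ))) := by
    rw [← setLIntegral_const]
    refine (setLIntegral_mono' measurableSet_Ioc fun τ hτ ↦ ?_).trans
      (lintegral_mono_set (Set.Ioc_subset_Ioi_self.trans (Set.Ioi_subset_Ioi (sq_nonneg a))))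
    have hτ0 : 0 < τ := lt_trans (by positivity) hτ.1
    rw [← ENNReal.ofReal_mul (by positivity)]
    refine ENNReal.ofReal_le_ofReal (mul_le_mul ?_ ?_ (by positivity) (by positivity))
    · exact Real.rpow_le_rpow_of_nonpos hτ0 hτ.2 (by norm_num)
    · refine Real.exp_le_exp.2 (neg_le_neg ?_)
      rw [div_le_one hτ0]
      exact hτ.1.le
  refine le_trans (le_of_eq ?_) (mul_le_mul_right h1 _)
  rw [Real.volume_Ioc, ← ENNReal.ofReal_mul (by positivity), ← ENNReal.ofReal_mul (by positivity)]
  congr 1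
  have h2 : (a ^ 2) ^ (-(5 / 2) : ℝ) = (a ^ 5)⁻¹ := by
    rw [← Real.rpow_natCast a, ← Real.rpow_mul ha.le, ← Real.rpow_natCast a, ← Real.rpow_neg ha.le]
    norm_num
  rw [Real.mul_rpow (by norm_num) (by positivity), h2, Real.rpow_neg (by norm_num), Real.exp_neg]
  have := Real.exp_pos 1
  field_simp
  ring

open ComplexConjugate in
/-- Quadratic estimate for the integral operator with unimodular kernel `e`, in a weighted
`L²` space. -/
theorem lintegral_weight_mul_enorm_sq_le {X Y : Type*} [MeasurableSpace X] [MeasurableSpace Y]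
    {ν : Measure X} {μ : Measure Y} [SFinite ν] [SFinite μ] {w : X → ℝ} (hw : Integrable w ν)
    (hw0 : ∀ x, 0 ≤ w x) {h : Y → ℂ} (hh : Integrable h μ) {e : X → Y → ℂ}
    (hem : Measurable (Function.uncurry e)) (he : ∀ x y, ‖e x y‖ = 1) :
    ∫⁻ x, ENNReal.ofReal (w x) * ‖∫ y, e x y * h y ∂μ‖ₑ ^ 2 ∂ν ≤
      ∫⁻ p : Y × Y, ‖h p.1‖ₑ * ‖h p.2‖ₑ *
        ‖∫ x, (w x : ℂ) * (e x p.1 * conj (e x p.2)) ∂ν‖ₑ ∂(μ.prod μ) := by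
  set v : X → ℂ := fun x ↦ ∫ y, e x y * h y ∂μ
  have hvm : AEStronglyMeasurable v ν :=
    (hem.aestronglyMeasurable.mul hh.aestronglyMeasurable.comp_snd).integral_prod_right'
  have hvb : ∀ x, ‖v x‖ ≤ ∫ y, ‖h y‖ ∂μ := by
    intro x
    refine (norm_integral_le_integral_norm _).trans (le_of_eq ?_)
    simp [he]
  have hint : Integrable (fun x ↦ w x * ‖v x‖ ^ 2) ν := by
    refine hw.mul_bdd (c := (∫ y, ‖h y‖ ∂μ) ^ 2) (hvm.norm.pow 2) ?_
    refine Filter.Eventually.of_forall fun x ↦ ?_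
    rw [norm_pow, norm_norm]
    exact pow_le_pow_left₀ (norm_nonneg _) (hvb x) 2
  have hprod : Integrable (fun p : Y × Y ↦ h p.1 * conj (h p.2)) (μ.prod μ) :=
    hh.mul_prod ((Complex.conjLIE.toContinuousLinearEquiv.integrable_comp_iff).2 hh)
  set F : X → Y × Y → ℂ := fun x p ↦
    (w x : ℂ) * (e x p.1 * conj (e x p.2)) * (h p.1 * conj (h p.2))
  have hF : Integrable (Function.uncurry F) (ν.prod (μ.prod μ)) := by
    have h1 : Integrable (fun q : X × (Y × Y) ↦ (w q.1 : ℂ) * (h q.2.1 * conj (h q.2.2)))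
        (ν.prod (μ.prod μ)) := hw.ofReal.mul_prod hprod
    have hm1 : Measurable fun q : X × (Y × Y) ↦ e q.1 q.2.1 :=
      hem.comp (f := fun q : X × (Y × Y) ↦ (q.1, q.2.1)) (by fun_prop)
    have hm2 : Measurable fun q : X × (Y × Y) ↦ e q.1 q.2.2 :=
      hem.comp (f := fun q : X × (Y × Y) ↦ (q.1, q.2.2)) (by fun_prop)
    have h2 := h1.mul_bdd (g := fun q : X × (Y × Y) ↦ e q.1 q.2.1 * conj (e q.1 q.2.2)) (c := 1)
      (hm1.mul (Complex.continuous_conj.measurable.comp hm2)).aestronglyMeasurable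
      (Filter.Eventually.of_forall fun q ↦ by simp [he])
    refine h2.congr (Filter.Eventually.of_forall fun q ↦ ?_)
    simp only [F, Function.uncurry]
    ring
  have hv2 : ∀ x, ((w x * ‖v x‖ ^ 2 : ℝ) : ℂ) = ∫ p, F x p ∂(μ.prod μ) := by
    intro x
    have h1 : ∀ p : Y × Y, F x p = (w x : ℂ) * ((e x p.1 * h p.1) * conj (e x p.2 * h p.2)) := by
      intro p
      simp only [F, map_mul]
      ring
    simp_rw [h1]
    rw [integral_const_mul, integral_prod_mul (fun y ↦ e x y * h y) (fun y ↦ conj (e x y * h y)),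
      integral_conj, Complex.mul_conj, Complex.normSq_eq_norm_sq]
    push_cast
    rfl
  have hlhs : ∫⁻ x, ENNReal.ofReal (w x) * ‖v x‖ₑ ^ 2 ∂ν =
      ‖∫ x, ((w x * ‖v x‖ ^ 2 : ℝ) : ℂ) ∂ν‖ₑ := by
    have h0 : ∀ x, 0 ≤ w x * ‖v x‖ ^ 2 := fun x ↦ mul_nonneg (hw0 x) (sq_nonneg _)
    rw [integral_complex_ofReal, ← ofReal_norm, Complex.norm_real,
      Real.norm_of_nonneg (integral_nonneg h0),
      ofReal_integral_eq_lintegral_ofReal hint (Filter.Eventually.of_forall h0)]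
    refine lintegral_congr fun x ↦ ?_
    rw [ENNReal.ofReal_mul (hw0 x), ENNReal.ofReal_pow (norm_nonneg _), ofReal_norm]
  rw [hlhs]
  simp_rw [hv2]
  rw [integral_integral_swap hF]
  refine (enorm_integral_le_lintegral_enorm _).trans (le_of_eq ?_)
  refine lintegral_congr fun p ↦ ?_
  simp only [F]
  rw [integral_mul_const, enorm_mul, enorm_mul, mul_comm]
  congr 2
  rw [← ofReal_norm, ← ofReal_norm, RCLike.norm_conj]

/-- The phase of the half-wave propagator with sign `σ`. -/
noncomputable def halfWavePhase {n : ℕ} (σ : ℝ) (z : ℝ × EuclideanSpace ℝ (Fin n))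
    (ξ : EuclideanSpace ℝ (Fin n)) : ℂ :=
  Complex.exp (Complex.I * ((⟪z.2, ξ⟫ + σ * (z.1 * ‖ξ‖) : ℝ) : ℂ))

theorem norm_halfWavePhase {n : ℕ} (σ : ℝ) (z : ℝ × EuclideanSpace ℝ (Fin n))
    (ξ : EuclideanSpace ℝ (Fin n)) : ‖halfWavePhase σ z ξ‖ = 1 := by
  rw [halfWavePhase, mul_comm, Complex.norm_exp_ofReal_mul_I]

theorem continuous_halfWavePhase {n : ℕ} (σ : ℝ) :
    Continuous (Function.uncurry (halfWavePhase (n := n) σ)) := by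
  simp only [Function.uncurry_def, halfWavePhase]
  fun_prop

theorem integral_gaussian_mul_phase {V : Type*} [NormedAddCommGroup V] [InnerProductSpace ℝ V]
    [FiniteDimensional ℝ V] [MeasurableSpace V] [BorelSpace V] {b : ℝ} (hb : 0 < b) (w : V) :
    ∫ v : V, (Real.exp (-(b * ‖v‖ ^ 2)) : ℂ) * Complex.exp (Complex.I * (⟪v, w⟫ : ℝ)) =
      (((Real.pi / b) ^ ((Module.finrank ℝ V : ℝ) / 2) *
        Real.exp (-(‖w‖ ^ 2 / (4 * b))) : ℝ) : ℂ) := by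
  have h := GaussianFourier.integral_cexp_neg_mul_sq_norm_add (V := V) (b := (b : ℂ))
    (by simpa using hb) Complex.I w
  convert! h using 2
  · ext v
    rw [Complex.ofReal_exp, ← Complex.exp_add, real_inner_comm]
    push_cast
    congr 1
    ring
  · push_cast
    rw [Complex.ofReal_cpow (by positivity)]
    push_cast
    congr 2
    rw [Complex.I_sq]
    ring

/-- The Fourier transform of the Gaussian weight, evaluated at the difference of two points of the
light cone. -/
noncomputable def coneKernel {n : ℕ} (δ τ : ℝ) (ξ η : EuclideanSpace ℝ (Fin n)) : ℝ :=
  (Real.pi * τ) ^ ((n : ℝ) / 2) * Real.exp (-(τ * ‖ξ - η‖ ^ 2 / 4)) *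
    ((Real.pi / δ) ^ ((1 : ℝ) / 2) * Real.exp (-((‖ξ‖ - ‖η‖) ^ 2 / (4 * δ))))

theorem integrable_gaussian_norm {V : Type*} [NormedAddCommGroup V] [InnerProductSpace ℝ V]
    [FiniteDimensional ℝ V] [MeasurableSpace V] [BorelSpace V] {b : ℝ} (hb : 0 < b) :
    Integrable fun v : V ↦ Real.exp (-(b * ‖v‖ ^ 2)) := by
  have h := (GaussianFourier.integrable_cexp_neg_mul_sq_norm_add (V := V) (b := (b : ℂ))
    (by simpa using hb) 0 0).norm
  refine h.congr (Filter.Eventually.of_forall fun v ↦ ?_)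
  simp [Complex.norm_exp, ← Complex.ofReal_pow]

open ComplexConjugate in
theorem integral_gaussian_mul_halfWavePhase {n : ℕ} {σ : ℝ} (hσ : σ ^ 2 = 1) {δ τ : ℝ}
    (hδ : 0 < δ) (hτ : 0 < τ) (ξ η : EuclideanSpace ℝ (Fin n)) :
    ∫ z : ℝ × EuclideanSpace ℝ (Fin n),
      ((Real.exp (-(δ * ‖z.1‖ ^ 2)) * Real.exp (-(τ⁻¹ * ‖z.2‖ ^ 2)) : ℝ) : ℂ) *
        (halfWavePhase σ z ξ * conj (halfWavePhase σ z η)) = (coneKernel δ τ ξ η : ℂ) := by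
  have h1 : ∀ z : ℝ × EuclideanSpace ℝ (Fin n),
      ((Real.exp (-(δ * ‖z.1‖ ^ 2)) * Real.exp (-(τ⁻¹ * ‖z.2‖ ^ 2)) : ℝ) : ℂ) *
        (halfWavePhase σ z ξ * conj (halfWavePhase σ z η)) =
      ((Real.exp (-(δ * ‖z.1‖ ^ 2)) : ℂ) *
        Complex.exp (Complex.I * (⟪z.1, σ * (‖ξ‖ - ‖η‖)⟫ : ℝ))) *
      ((Real.exp (-(τ⁻¹ * ‖z.2‖ ^ 2)) : ℂ) *
        Complex.exp (Complex.I * (⟪z.2, ξ - η⟫ : ℝ))) := by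
    intro z
    have : halfWavePhase σ z ξ * conj (halfWavePhase σ z η) =
        Complex.exp (Complex.I * (⟪z.1, σ * (‖ξ‖ - ‖η‖)⟫ : ℝ)) *
        Complex.exp (Complex.I * (⟪z.2, ξ - η⟫ : ℝ)) := by
      rw [halfWavePhase, halfWavePhase, ← Complex.exp_conj, ← Complex.exp_add, ← Complex.exp_add,
        inner_sub_right]
      congr 1
      simp only [map_mul, Complex.conj_I, Complex.conj_ofReal]
      simp
      ring
    rw [this]
    push_cast
    ring
  simp_rw [h1]
  rw [volume_eq_prod, integral_prod_mul
    (fun t : ℝ ↦ (Real.exp (-(δ * ‖t‖ ^ 2)) : ℂ) *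
        Complex.exp (Complex.I * (⟪t, σ * (‖ξ‖ - ‖η‖)⟫ : ℝ)))
    (fun x : EuclideanSpace ℝ (Fin n) ↦ (Real.exp (-(τ⁻¹ * ‖x‖ ^ 2)) : ℂ) *
        Complex.exp (Complex.I * (⟪x, ξ - η⟫ : ℝ))),
    integral_gaussian_mul_phase hδ, integral_gaussian_mul_phase (inv_pos.2 hτ),
    ← Complex.ofReal_mul, coneKernel]
  congr 1
  rw [mul_comm]
  simp only [finrank_euclideanSpace, Fintype.card_fin, Module.finrank_self, Nat.cast_one,
    norm_mul, mul_pow, Real.norm_eq_abs, sq_abs, hσ, one_mul, div_inv_eq_mul]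
  congr 3
  field_simp

theorem lintegral_gaussian_mul_halfWave_sq_le {n : ℕ} {σ : ℝ} (hσ : σ ^ 2 = 1) {δ τ : ℝ}
    (hδ : 0 < δ) (hτ : 0 < τ) {h : EuclideanSpace ℝ (Fin n) → ℂ} (hh : Integrable h) :
    ∫⁻ z : ℝ × EuclideanSpace ℝ (Fin n),
      ENNReal.ofReal (Real.exp (-(δ * ‖z.1‖ ^ 2)) * Real.exp (-(τ⁻¹ * ‖z.2‖ ^ 2))) *
        ‖∫ ξ, halfWavePhase σ z ξ * h ξ‖ₑ ^ 2 ≤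
      ∫⁻ p : EuclideanSpace ℝ (Fin n) × EuclideanSpace ℝ (Fin n),
        ‖h p.1‖ₑ * ‖h p.2‖ₑ * ENNReal.ofReal (coneKernel δ τ p.1 p.2) := by
  have hw : Integrable fun z : ℝ × EuclideanSpace ℝ (Fin n) ↦
      Real.exp (-(δ * ‖z.1‖ ^ 2)) * Real.exp (-(τ⁻¹ * ‖z.2‖ ^ 2)) :=
    (integrable_gaussian_norm hδ).mul_prod (integrable_gaussian_norm (inv_pos.2 hτ))
  refine (lintegral_weight_mul_enorm_sq_le hw (fun z ↦ by positivity) hh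
    (continuous_halfWavePhase σ).measurable (norm_halfWavePhase σ)).trans (le_of_eq ?_)
  refine lintegral_congr fun p ↦ ?_
  have h0 : 0 ≤ coneKernel δ τ p.1 p.2 := by
    unfold coneKernel
    positivity
  rw [integral_gaussian_mul_halfWavePhase hσ hδ hτ, ← ofReal_norm (coneKernel δ τ p.1 p.2 : ℂ),
    Complex.norm_real, Real.norm_of_nonneg h0]

theorem measurable_halfWave {n : ℕ} (σ : ℝ) {h : EuclideanSpace ℝ (Fin n) → ℂ}
    (hm : Measurable h) :
    Measurable fun z : ℝ × EuclideanSpace ℝ (Fin n) ↦ ∫ ξ, halfWavePhase σ z ξ * h ξ := by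
  have : Measurable (Function.uncurry fun (z : ℝ × EuclideanSpace ℝ (Fin n)) ξ ↦
      halfWavePhase σ z ξ * h ξ) :=
    (continuous_halfWavePhase σ).measurable.mul (hm.comp measurable_snd)
  exact this.stronglyMeasurable.integral_prod_right.measurable

/-- Schur test with the weight `|ξ|⁻²` for a symmetric kernel. -/
theorem lintegral_prod_mul_le_of_schur {n : ℕ} [Nonempty (Fin n)]
    {L : EuclideanSpace ℝ (Fin n) → EuclideanSpace ℝ (Fin n) → ℝ≥0∞}
    (hL : Measurable (Function.uncurry L)) (hsymm : ∀ ξ η, L ξ η = L η ξ) {A : ℝ≥0∞}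
    (hA : ∀ ξ, ∫⁻ η, (‖η‖ₑ ^ 2)⁻¹ * L ξ η ≤ A) {h : EuclideanSpace ℝ (Fin n) → ℂ}
    (hm : Measurable h) :
    ∫⁻ p : EuclideanSpace ℝ (Fin n) × EuclideanSpace ℝ (Fin n), ‖h p.1‖ₑ * ‖h p.2‖ₑ * L p.1 p.2 ≤
      2 * A * ∫⁻ ξ, ‖h ξ‖ₑ ^ 2 * ‖ξ‖ₑ ^ 2 := by
  set D : EuclideanSpace ℝ (Fin n) × EuclideanSpace ℝ (Fin n) → ℝ≥0∞ := fun p ↦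
    ‖h p.1‖ₑ ^ 2 * ‖p.1‖ₑ ^ 2 * ((‖p.2‖ₑ ^ 2)⁻¹ * L p.1 p.2) with hD
  have hDm : Measurable D := by
    have : Measurable fun p : EuclideanSpace ℝ (Fin n) × EuclideanSpace ℝ (Fin n) ↦
      L p.1 p.2 := hL
    fun_prop
  have hDle : ∫⁻ p, D p ≤ A * ∫⁻ ξ, ‖h ξ‖ₑ ^ 2 * ‖ξ‖ₑ ^ 2 := by
    rw [volume_eq_prod, lintegral_prod _ hDm.aemeasurable, ← lintegral_const_mul _ (by fun_prop)]
    refine lintegral_mono fun ξ ↦ ?_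
    have hLξ : Measurable fun η ↦ L ξ η := hL.comp measurable_prodMk_left
    rw [hD]
    simp only
    rw [lintegral_const_mul _ (by fun_prop), mul_comm]
    exact mul_le_mul_left (hA ξ) _
  have hswap : ∫⁻ p : EuclideanSpace ℝ (Fin n) × EuclideanSpace ℝ (Fin n), D p.swap =
      ∫⁻ p, D p := by
    rw [volume_eq_prod]
    exact lintegral_prod_swap D
  have hne : ∀ᵐ x : EuclideanSpace ℝ (Fin n), x ≠ 0 := by simp [ae_iff]
  have hne2 : ∀ᵐ p : EuclideanSpace ℝ (Fin n) × EuclideanSpace ℝ (Fin n), p.1 ≠ 0 ∧ p.2 ≠ 0 :=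
    (quasiMeasurePreserving_fst.ae hne).and (quasiMeasurePreserving_snd.ae hne)
  calc _ ≤ ∫⁻ p : EuclideanSpace ℝ (Fin n) × EuclideanSpace ℝ (Fin n), (D p + D p.swap) := by
        refine lintegral_mono_ae ?_
        filter_upwards [hne2] with p hp
        have hX : ‖p.1‖ₑ ≠ 0 := by simpa using hp.1
        have hY : ‖p.2‖ₑ ≠ 0 := by simpa using hp.2
        have hX' : ‖p.1‖ₑ ≠ ∞ := enorm_ne_top
        have hY' : ‖p.2‖ₑ ≠ ∞ := enorm_ne_top
        simp only [hD, Prod.fst_swap, Prod.snd_swap]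
        rw [hsymm p.2 p.1, ← mul_assoc (_ * _), ← mul_assoc (_ * _), ← add_mul]
        refine mul_le_mul_left ?_ _
        rw [ENNReal.inv_pow, ENNReal.inv_pow, ← mul_pow, ← mul_pow, ← mul_pow, ← mul_pow]
        set u := ‖h p.1‖ₑ * ‖p.1‖ₑ * ‖p.2‖ₑ⁻¹ with hu
        set w := ‖h p.2‖ₑ * ‖p.2‖ₑ * ‖p.1‖ₑ⁻¹ with hw
        have huw : ‖h p.1‖ₑ * ‖h p.2‖ₑ = u * w := by
          have h1 := ENNReal.mul_inv_cancel hX hX'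
          have h2 := ENNReal.mul_inv_cancel hY hY'
          calc ‖h p.1‖ₑ * ‖h p.2‖ₑ = ‖h p.1‖ₑ * ‖h p.2‖ₑ * (‖p.1‖ₑ * ‖p.1‖ₑ⁻¹) *
                (‖p.2‖ₑ * ‖p.2‖ₑ⁻¹) := by rw [h1, h2, mul_one, mul_one]
            _ = u * w := by rw [hu, hw]; ring
        rw [huw]
        rcases le_total u w with h1 | h1
        · exact (mul_le_mul_left h1 w).trans (by rw [← sq]; exact le_add_self)
        · exact (mul_le_mul_right h1 u).trans (by rw [← sq]; exact le_self_add)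
    _ = (∫⁻ p, D p) + ∫⁻ p, D p := by rw [lintegral_add_left hDm, hswap]
    _ ≤ _ := by
        rw [← two_mul, mul_assoc]
        exact mul_le_mul_right hDle 2

theorem lintegral_radial_gaussian {δ : ℝ} (hδ : 0 < δ) (a : ℝ) :
    ∫⁻ r : ℝ, ENNReal.ofReal ((Real.pi / δ) ^ ((1 : ℝ) / 2) *
      Real.exp (-((a - r) ^ 2 / (4 * δ)))) = ENNReal.ofReal (2 * Real.pi) := by
  have hb : 0 < (4 * δ)⁻¹ := by positivity
  have h1 : ∀ r : ℝ, Real.exp (-((a - r) ^ 2 / (4 * δ))) =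
      (fun y ↦ Real.exp (-(4 * δ)⁻¹ * y ^ 2)) (a - r) := by
    intro r
    simp only
    congr 1
    rw [div_eq_mul_inv]
    ring
  have hint : Integrable fun r : ℝ ↦ (Real.pi / δ) ^ ((1 : ℝ) / 2) *
      Real.exp (-((a - r) ^ 2 / (4 * δ))) := by
    simp_rw [h1]
    exact ((integrable_exp_neg_mul_sq hb).comp_sub_left a).const_mul _
  rw [← ofReal_integral_eq_lintegral_ofReal hint
    (Filter.Eventually.of_forall fun r ↦ by positivity), integral_const_mul]
  simp_rw [h1]
  rw [integral_sub_left_eq_self (fun y ↦ Real.exp (-(4 * δ)⁻¹ * y ^ 2)) volume a,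
    integral_gaussian, ← Real.sqrt_eq_rpow, ← Real.sqrt_mul (by positivity)]
  congr 1
  rw [show Real.pi / δ * (Real.pi / (4 * δ)⁻¹) = (2 * Real.pi) ^ 2 by field_simp; ring]
  exact Real.sqrt_sq (by positivity)

theorem exists_lintegral_gaussian_mul_halfWave_le {n : ℕ} (hn : 4 ≤ n) :
    ∃ C : ℝ≥0∞, C ≠ ∞ ∧ ∀ σ : ℝ, σ ^ 2 = 1 → ∀ h : EuclideanSpace ℝ (Fin n) → ℂ, Measurable h →
      Integrable h → ∀ δ : ℝ, 0 < δ →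
      ∫⁻ z : ℝ × EuclideanSpace ℝ (Fin n), ENNReal.ofReal (Real.exp (-(δ * ‖z.1‖ ^ 2))) *
        (‖∫ ξ, halfWavePhase σ z ξ * h ξ‖ₑ ^ 2 * ENNReal.ofReal ((‖z.2‖ ^ 3)⁻¹)) ≤
      C * ∫⁻ ξ, ‖h ξ‖ₑ ^ 2 * ‖ξ‖ₑ ^ 2 := by
  have : Nonempty (Fin n) := ⟨⟨0, by omega⟩⟩
  obtain ⟨M, hM, hMle⟩ := exists_lintegral_radial_mul_enorm_sub_rpow_le hn
  obtain ⟨C₁, hC₁, hC₁le⟩ := exists_lintegral_gaussian_scales_le hn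
  set C₀ := ENNReal.ofReal (2 ^ (5 / 2 : ℝ) * Real.exp 1)
  have hC₀ : C₀ ≠ ∞ := ENNReal.ofReal_ne_top
  refine ⟨C₀ * (C₁ * (2 * (M * ENNReal.ofReal (2 * Real.pi)))), ?_, ?_⟩
  · exact ENNReal.mul_ne_top hC₀ (ENNReal.mul_ne_top hC₁ (ENNReal.mul_ne_top (by simp)
      (ENNReal.mul_ne_top hM ENNReal.ofReal_ne_top)))
  intro σ hσ h hm hh δ hδ
  set v : ℝ × EuclideanSpace ℝ (Fin n) → ℂ := fun z ↦ ∫ ξ, halfWavePhase σ z ξ * h ξ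
  have hv : Measurable v := measurable_halfWave σ hm
  set φ : EuclideanSpace ℝ (Fin n) → EuclideanSpace ℝ (Fin n) → ℝ≥0∞ := fun ξ η ↦
    ENNReal.ofReal ((Real.pi / δ) ^ ((1 : ℝ) / 2) * Real.exp (-((‖ξ‖ - ‖η‖) ^ 2 / (4 * δ))))
    with hφ
  set L : EuclideanSpace ℝ (Fin n) → EuclideanSpace ℝ (Fin n) → ℝ≥0∞ := fun ξ η ↦
    ‖ξ - η‖ₑ ^ (-((n : ℝ) - 3)) * φ ξ η with hL
  have hφm : Measurable fun p : EuclideanSpace ℝ (Fin n) × EuclideanSpace ℝ (Fin n) ↦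
      φ p.1 p.2 := by
    fun_prop
  have hLm : Measurable fun p : EuclideanSpace ℝ (Fin n) × EuclideanSpace ℝ (Fin n) ↦
      L p.1 p.2 := by
    fun_prop
  have hKm : Measurable fun q : ℝ × EuclideanSpace ℝ (Fin n) × EuclideanSpace ℝ (Fin n) ↦
      coneKernel δ q.1 q.2.1 q.2.2 := by
    unfold coneKernel
    fun_prop
  calc _ ≤ ∫⁻ z : ℝ × EuclideanSpace ℝ (Fin n), C₀ * ∫⁻ τ in Set.Ioi (0 : ℝ),
        ENNReal.ofReal (τ ^ (-(5 / 2) : ℝ)) *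
          (ENNReal.ofReal (Real.exp (-(δ * ‖z.1‖ ^ 2)) * Real.exp (-(τ⁻¹ * ‖z.2‖ ^ 2))) *
            ‖v z‖ₑ ^ 2) := by
        refine lintegral_mono fun z ↦ ?_
        by_cases hz : z.2 = 0
        · simp [hz]
        have hz' := ofReal_inv_pow_three_le (norm_pos_iff.2 hz)
        have h1 : ∫⁻ τ in Set.Ioi (0 : ℝ), ENNReal.ofReal (τ ^ (-(5 / 2) : ℝ)) *
            (ENNReal.ofReal (Real.exp (-(δ * ‖z.1‖ ^ 2)) * Real.exp (-(τ⁻¹ * ‖z.2‖ ^ 2))) *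
            ‖v z‖ₑ ^ 2) = (ENNReal.ofReal (Real.exp (-(δ * ‖z.1‖ ^ 2))) * ‖v z‖ₑ ^ 2) *
            ∫⁻ τ in Set.Ioi (0 : ℝ), ENNReal.ofReal (τ ^ (-(5 / 2) : ℝ)) *
              ENNReal.ofReal (Real.exp (-(‖z.2‖ ^ 2 / τ))) := by
          rw [← lintegral_const_mul _ (by fun_prop)]
          refine lintegral_congr fun τ ↦ ?_
          rw [ENNReal.ofReal_mul (by positivity), inv_mul_eq_div]
          ring
        rw [h1, ← mul_assoc]
        calc _ ≤ ENNReal.ofReal (Real.exp (-(δ * ‖z.1‖ ^ 2))) * ‖v z‖ₑ ^ 2 * _ :=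
              mul_le_mul_right hz' _
          _ = _ := by ring
    _ = C₀ * ∫⁻ τ in Set.Ioi (0 : ℝ), ENNReal.ofReal (τ ^ (-(5 / 2) : ℝ)) *
          ∫⁻ z : ℝ × EuclideanSpace ℝ (Fin n),
          (ENNReal.ofReal (Real.exp (-(δ * ‖z.1‖ ^ 2)) * Real.exp (-(τ⁻¹ * ‖z.2‖ ^ 2))) *
            ‖v z‖ₑ ^ 2) := by
        have hjoint : Measurable (Function.uncurry fun (z : ℝ × EuclideanSpace ℝ (Fin n))
            (τ : ℝ) ↦ ENNReal.ofReal (τ ^ (-(5 / 2) : ℝ)) *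
          (ENNReal.ofReal (Real.exp (-(δ * ‖z.1‖ ^ 2)) * Real.exp (-(τ⁻¹ * ‖z.2‖ ^ 2))) *
            ‖v z‖ₑ ^ 2)) := by
          simp only [Function.uncurry_def]
          fun_prop
        rw [lintegral_const_mul _ hjoint.lintegral_prod_right,
          lintegral_lintegral_swap hjoint.aemeasurable]
        congr 1
        refine lintegral_congr fun τ ↦ ?_
        rw [lintegral_const_mul _ (by fun_prop)]
    _ ≤ C₀ * ∫⁻ τ in Set.Ioi (0 : ℝ), ENNReal.ofReal (τ ^ (-(5 / 2) : ℝ)) *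
          ∫⁻ p : EuclideanSpace ℝ (Fin n) × EuclideanSpace ℝ (Fin n),
            ‖h p.1‖ₑ * ‖h p.2‖ₑ * ENNReal.ofReal (coneKernel δ τ p.1 p.2) := by
        refine mul_le_mul_right (setLIntegral_mono' measurableSet_Ioi fun τ hτ ↦ ?_) _
        exact mul_le_mul_right (lintegral_gaussian_mul_halfWave_sq_le hσ hδ hτ hh) _
    _ = C₀ * ∫⁻ p : EuclideanSpace ℝ (Fin n) × EuclideanSpace ℝ (Fin n),
          ‖h p.1‖ₑ * ‖h p.2‖ₑ * ∫⁻ τ in Set.Ioi (0 : ℝ), ENNReal.ofReal (τ ^ (-(5 / 2) : ℝ)) *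
            ENNReal.ofReal (coneKernel δ τ p.1 p.2) := by
        have hjoint : Measurable (Function.uncurry fun (τ : ℝ)
            (p : EuclideanSpace ℝ (Fin n) × EuclideanSpace ℝ (Fin n)) ↦
            ENNReal.ofReal (τ ^ (-(5 / 2) : ℝ)) *
            (‖h p.1‖ₑ * ‖h p.2‖ₑ * ENNReal.ofReal (coneKernel δ τ p.1 p.2))) := by
          simp only [Function.uncurry_def]
          fun_prop
        congr 1
        calc _ = ∫⁻ τ in Set.Ioi (0 : ℝ),
              ∫⁻ p : EuclideanSpace ℝ (Fin n) × EuclideanSpace ℝ (Fin n),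
              ENNReal.ofReal (τ ^ (-(5 / 2) : ℝ)) *
              (‖h p.1‖ₑ * ‖h p.2‖ₑ * ENNReal.ofReal (coneKernel δ τ p.1 p.2)) := by
              refine lintegral_congr fun τ ↦ ?_
              have : Measurable fun p : EuclideanSpace ℝ (Fin n) × EuclideanSpace ℝ (Fin n) ↦
                  coneKernel δ τ p.1 p.2 := hKm.comp measurable_prodMk_left
              rw [lintegral_const_mul _ (by fun_prop)]
          _ = _ := by
              rw [lintegral_lintegral_swap hjoint.aemeasurable]
              refine lintegral_congr fun p ↦ ?_
              have : Measurable fun τ : ℝ ↦ coneKernel δ τ p.1 p.2 :=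
                hKm.comp measurable_prodMk_right
              rw [← lintegral_const_mul _ (by fun_prop)]
              refine lintegral_congr fun τ ↦ ?_
              ring
    _ ≤ C₀ * ∫⁻ p : EuclideanSpace ℝ (Fin n) × EuclideanSpace ℝ (Fin n),
          C₁ * (‖h p.1‖ₑ * ‖h p.2‖ₑ * L p.1 p.2) := by
        refine mul_le_mul_right (lintegral_mono fun p ↦ ?_) _
        have h1 : ∫⁻ τ in Set.Ioi (0 : ℝ), ENNReal.ofReal (τ ^ (-(5 / 2) : ℝ)) *
            ENNReal.ofReal (coneKernel δ τ p.1 p.2) =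
            (∫⁻ τ in Set.Ioi (0 : ℝ), ENNReal.ofReal (τ ^ (-(5 / 2) : ℝ)) *
              ENNReal.ofReal ((Real.pi * τ) ^ ((n : ℝ) / 2) *
                Real.exp (-(τ * ‖p.1 - p.2‖ ^ 2 / 4)))) * φ p.1 p.2 := by
          rw [← lintegral_mul_const _ (by fun_prop)]
          refine setLIntegral_congr_fun measurableSet_Ioi fun τ hτ ↦ ?_
          have hτ' : (0 : ℝ) < τ := hτ
          simp only [coneKernel, hφ]
          rw [ENNReal.ofReal_mul (by positivity), mul_assoc]
        rw [h1]
        calc _ ≤ ‖h p.1‖ₑ * ‖h p.2‖ₑ * ((C₁ * ‖p.1 - p.2‖ₑ ^ (-((n : ℝ) - 3))) * φ p.1 p.2) :=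
              mul_le_mul_right (mul_le_mul_left (hC₁le _) _) _
          _ = _ := by
              simp only [hL]
              ring
    _ ≤ C₀ * (C₁ * (2 * (M * ENNReal.ofReal (2 * Real.pi)) * ∫⁻ ξ, ‖h ξ‖ₑ ^ 2 * ‖ξ‖ₑ ^ 2)) := by
        rw [lintegral_const_mul _ (by fun_prop)]
        refine mul_le_mul_right (mul_le_mul_right ?_ _) _
        refine lintegral_prod_mul_le_of_schur hLm ?_ ?_ hm
        · intro ξ η
          simp only [hL, hφ]
          rw [← ofReal_norm, ← ofReal_norm, norm_sub_rev, sub_sq_comm]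
        · intro ξ
          refine (hMle (fun r ↦ ENNReal.ofReal ((Real.pi / δ) ^ ((1 : ℝ) / 2) *
            Real.exp (-((‖ξ‖ - r) ^ 2 / (4 * δ))))) (by fun_prop) ξ).trans (le_of_eq ?_)
          rw [lintegral_radial_gaussian hδ]
    _ = _ := by ring

theorem exists_lintegral_halfWave_le {n : ℕ} (hn : 4 ≤ n) :
    ∃ C : ℝ≥0∞, C ≠ ∞ ∧ ∀ σ : ℝ, σ ^ 2 = 1 → ∀ h : EuclideanSpace ℝ (Fin n) → ℂ, Measurable h →
      Integrable h →
      ∫⁻ z : ℝ × EuclideanSpace ℝ (Fin n),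
        ‖∫ ξ, halfWavePhase σ z ξ * h ξ‖ₑ ^ 2 * ENNReal.ofReal ((‖z.2‖ ^ 3)⁻¹) ≤
      C * ∫⁻ ξ, ‖h ξ‖ₑ ^ 2 * ‖ξ‖ₑ ^ 2 := by
  obtain ⟨C, hC, hCle⟩ := exists_lintegral_gaussian_mul_halfWave_le hn
  refine ⟨C, hC, fun σ hσ h hm hh ↦ ?_⟩
  set F : ℝ × EuclideanSpace ℝ (Fin n) → ℝ≥0∞ := fun z ↦
    ‖∫ ξ, halfWavePhase σ z ξ * h ξ‖ₑ ^ 2 * ENNReal.ofReal ((‖z.2‖ ^ 3)⁻¹)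
  have hF : Measurable F := by
    have := measurable_halfWave σ hm
    fun_prop
  set G : ℕ → ℝ × EuclideanSpace ℝ (Fin n) → ℝ≥0∞ := fun k z ↦
    ENNReal.ofReal (Real.exp (-(1 / ((k : ℝ) + 1) * ‖z.1‖ ^ 2))) * F z
  have hG : ∀ z, Filter.Tendsto (fun k ↦ G k z) Filter.atTop (nhds (F z)) := by
    intro z
    have h1 : Filter.Tendsto (fun k : ℕ ↦ Real.exp (-(1 / ((k : ℝ) + 1) * ‖z.1‖ ^ 2)))
        Filter.atTop (nhds 1) := by
      have h2 := (tendsto_one_div_add_atTop_nhds_zero_nat (𝕜 := ℝ)).mul_const (‖z.1‖ ^ 2)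
      have h3 := (Real.continuous_exp.tendsto _).comp h2.neg
      simpa [Function.comp_def] using h3
    have h4 := ENNReal.Tendsto.mul_const (b := F z) (ENNReal.tendsto_ofReal h1)
      (Or.inl (by simp))
    rw [ENNReal.ofReal_one, one_mul] at h4
    exact h4
  calc ∫⁻ z, F z = ∫⁻ z, Filter.liminf (fun k ↦ G k z) Filter.atTop :=
        lintegral_congr fun z ↦ (hG z).liminf_eq.symm
    _ ≤ Filter.liminf (fun k ↦ ∫⁻ z, G k z) Filter.atTop :=
        lintegral_liminf_le fun k ↦ by fun_prop
    _ ≤ Filter.liminf (fun _ : ℕ ↦ C * ∫⁻ ξ, ‖h ξ‖ₑ ^ 2 * ‖ξ‖ₑ ^ 2) Filter.atTop :=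
        Filter.liminf_le_liminf (Filter.Eventually.of_forall fun k ↦
          hCle σ hσ h hm hh _ (by positivity))
    _ = _ := Filter.liminf_const _

theorem exists_schwartzMap_coe_eq_fourierT {n : ℕ} (f : SchwartzMap (EuclideanSpace ℝ (Fin n)) ℂ) :
    ∃ φ : SchwartzMap (EuclideanSpace ℝ (Fin n)) ℂ, ⇑φ = fourierT ⇑f ∧
      ∫ ξ, ‖φ ξ‖ ^ 2 = ∫ x, ‖f x‖ ^ 2 := by
  have hπ : (0 : ℝ) < 2 * Real.pi := by positivity
  set c : ℝ := (2 * Real.pi) ^ (-(n : ℝ) / 2) with hc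
  set e : EuclideanSpace ℝ (Fin n) ≃L[ℝ] EuclideanSpace ℝ (Fin n) :=
    ContinuousLinearEquiv.smulLeft (Units.mk0 (2 * Real.pi)⁻¹ (inv_ne_zero hπ.ne')) with he
  have hcoe : ∀ ξ, (((c : ℂ) • SchwartzMap.compCLMOfContinuousLinearEquiv ℂ e
      (FourierTransform.fourier f) : SchwartzMap (EuclideanSpace ℝ (Fin n)) ℂ)) ξ =
      c * (FourierTransform.fourier f : SchwartzMap (EuclideanSpace ℝ (Fin n)) ℂ)
        ((2 * Real.pi)⁻¹ • ξ) := fun ξ ↦ rfl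
  refine ⟨(c : ℂ) • SchwartzMap.compCLMOfContinuousLinearEquiv ℂ e (FourierTransform.fourier f),
    ?_, ?_⟩
  · funext ξ
    rw [hcoe, SchwartzMap.fourier_coe, Real.fourier_eq', fourierT]
    congr 1
    refine integral_congr_ae (Filter.Eventually.of_forall fun x ↦ ?_)
    simp only [smul_eq_mul]
    congr 2
    rw [inner_smul_right]
    have : -2 * Real.pi * ((2 * Real.pi)⁻¹ * ⟪x, ξ⟫) = -⟪x, ξ⟫ := by field_simp
    rw [this]
    push_cast
    ring
  · simp_rw [hcoe]
    simp_rw [norm_mul, mul_pow]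
    rw [integral_const_mul, integral_comp_smul volume (fun y ↦
      ‖(FourierTransform.fourier f : SchwartzMap (EuclideanSpace ℝ (Fin n)) ℂ) y‖ ^ 2),
      SchwartzMap.integral_norm_sq_fourier, smul_eq_mul, ← mul_assoc]
    have : ‖(c : ℂ)‖ ^ 2 *
        |(((2 * Real.pi)⁻¹ ^ Module.finrank ℝ (EuclideanSpace ℝ (Fin n)))⁻¹)| = 1 := by
      rw [Complex.norm_real, Real.norm_eq_abs, sq_abs, hc, finrank_euclideanSpace_fin,
        ← Real.rpow_natCast _ 2, ← Real.rpow_mul hπ.le, inv_pow, inv_inv, abs_of_pos (by positivity),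
        ← Real.rpow_natCast _ n, ← Real.rpow_add hπ]
      norm_num
    rw [this, one_mul]

theorem SchwartzMap.integrable_div_norm {n : ℕ} (hn : 2 ≤ n)
    (φ : SchwartzMap (EuclideanSpace ℝ (Fin n)) ℂ) :
    Integrable fun ξ ↦ φ ξ / (‖ξ‖ : ℂ) := by
  have : Nonempty (Fin n) := ⟨⟨0, by omega⟩⟩
  have hball : IntegrableOn (fun ξ : EuclideanSpace ℝ (Fin n) ↦ ‖ξ‖⁻¹) (Metric.ball 0 1) := by
    rw [integrableOn_fun_norm_addHaar volume (f := fun r ↦ r⁻¹), finrank_euclideanSpace_fin]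
    have h1 : IntegrableOn (fun y : ℝ ↦ y ^ (n - 2)) (Set.Ioo 0 1) :=
      ((continuous_pow (n - 2)).integrableOn_Icc (a := 0) (b := 1)).mono_set Set.Ioo_subset_Icc_self
    refine h1.congr_fun (fun y hy ↦ ?_) measurableSet_Ioo
    have hy0 : y ≠ 0 := hy.1.ne'
    simp only [smul_eq_mul]
    rw [show n - 1 = n - 2 + 1 by omega, pow_succ, mul_assoc, mul_inv_cancel₀ hy0, mul_one]
  obtain ⟨B, hB⟩ : ∃ B, ∀ ξ, ‖φ ξ‖ ≤ B := by
    obtain ⟨B, -, hB⟩ := φ.decay 0 0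
    exact ⟨B, fun ξ ↦ by simpa using hB ξ⟩
  refine Integrable.mono' ((((integrable_indicator_iff measurableSet_ball).2 hball).const_mul B).add
    φ.integrable.norm) ?_ (Filter.Eventually.of_forall fun ξ ↦ ?_)
  · exact (φ.continuous.measurable.div (by fun_prop)).aestronglyMeasurable
  · rw [norm_div, Complex.norm_real, norm_norm, Pi.add_apply]
    by_cases hξ : ξ ∈ Metric.ball (0 : EuclideanSpace ℝ (Fin n)) 1
    · rw [Set.indicator_of_mem hξ, div_eq_mul_inv]
      have := mul_le_mul_of_nonneg_right (hB ξ) (inv_nonneg.2 (norm_nonneg ξ))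
      linarith [norm_nonneg (φ ξ)]
    · rw [Set.indicator_of_notMem hξ, mul_zero, zero_add]
      refine div_le_self (norm_nonneg _) ?_
      simpa using hξ

theorem SchwartzMap.integrable_norm_sq {n : ℕ} (φ : SchwartzMap (EuclideanSpace ℝ (Fin n)) ℂ) :
    Integrable fun ξ ↦ ‖φ ξ‖ ^ 2 :=
  (φ.memLp 2 volume).integrable_norm_pow (by norm_num)

theorem SchwartzMap.integrable_one_add_norm_sq_rpow_mul {n : ℕ}
    (φ : SchwartzMap (EuclideanSpace ℝ (Fin n)) ℂ) :
    Integrable fun ξ ↦ (1 + ‖ξ‖ ^ 2) ^ (1 : ℝ) * ‖φ ξ‖ ^ 2 := by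
  obtain ⟨B, hB⟩ : ∃ B, ∀ ξ, ‖φ ξ‖ ≤ B := by
    obtain ⟨B, -, hB⟩ := φ.decay 0 0
    exact ⟨B, fun ξ ↦ by simpa using hB ξ⟩
  have h1 : Integrable fun ξ ↦ ‖ξ‖ ^ 2 * ‖φ ξ‖ * ‖φ ξ‖ :=
    (φ.integrable_pow_mul volume 2).mul_bdd (c := B) φ.continuous.norm.aestronglyMeasurable
      (Filter.Eventually.of_forall fun ξ ↦ by simpa using hB ξ)
  refine (φ.integrable_norm_sq.add h1).congr (Filter.Eventually.of_forall fun ξ ↦ ?_)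
  simp only [Real.rpow_one, Pi.add_apply]
  ring

/-- The half-wave component with sign `σ` of Cauchy data with Fourier transforms `F` and `G`. -/
noncomputable def halfWaveDatum {n : ℕ} (σ : ℝ) (F G : EuclideanSpace ℝ (Fin n) → ℂ)
    (ξ : EuclideanSpace ℝ (Fin n)) : ℂ :=
  (F ξ - Complex.I * σ * (G ξ / (‖ξ‖ : ℂ))) / 2

theorem wave_multiplier_eq_add_halfWave {n : ℕ} (F G : EuclideanSpace ℝ (Fin n) → ℂ) (t : ℝ)
    (x ξ : EuclideanSpace ℝ (Fin n)) :
    Complex.exp (Complex.I * (⟪x, ξ⟫ : ℝ)) * (((Real.cos (t * ‖ξ‖) : ℝ) : ℂ) * F ξ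
        + ((Real.sin (t * ‖ξ‖) / ‖ξ‖ : ℝ) : ℂ) * G ξ) =
      halfWavePhase 1 (t, x) ξ * halfWaveDatum 1 F G ξ +
        halfWavePhase (-1) (t, x) ξ * halfWaveDatum (-1) F G ξ := by
  have hI : Complex.I ^ 2 = -1 := Complex.I_sq
  simp only [halfWavePhase, halfWaveDatum]
  rw [show Complex.I * ((⟪x, ξ⟫ + 1 * (t * ‖ξ‖) : ℝ) : ℂ) =
      Complex.I * (⟪x, ξ⟫ : ℝ) + ((t * ‖ξ‖ : ℝ) : ℂ) * Complex.I by push_cast; ring,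
    show Complex.I * ((⟪x, ξ⟫ + -1 * (t * ‖ξ‖) : ℝ) : ℂ) =
      Complex.I * (⟪x, ξ⟫ : ℝ) + (-(t * ‖ξ‖ : ℝ) : ℂ) * Complex.I by push_cast; ring,
    Complex.exp_add, Complex.exp_add, Complex.exp_mul_I, Complex.exp_mul_I, Complex.cos_neg,
    Complex.sin_neg, Complex.ofReal_div, Complex.ofReal_cos, Complex.ofReal_sin, div_eq_mul_inv,
    div_eq_mul_inv (G ξ)]
  push_cast
  linear_combination (Complex.exp (Complex.I * (⟪x, ξ⟫ : ℝ)) * Complex.sin (t * ‖ξ‖) *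
    (‖ξ‖ : ℂ)⁻¹ * G ξ) * hI

theorem enorm_halfWaveDatum_sq_mul_le {n : ℕ} {σ : ℝ} (hσ : σ ^ 2 = 1)
    (F G : EuclideanSpace ℝ (Fin n) → ℂ) (ξ : EuclideanSpace ℝ (Fin n)) :
    ‖halfWaveDatum σ F G ξ‖ₑ ^ 2 * ‖ξ‖ₑ ^ 2 ≤
      ENNReal.ofReal ((1 + ‖ξ‖ ^ 2) ^ (1 : ℝ) * ‖F ξ‖ ^ 2 + ‖G ξ‖ ^ 2) := by
  have hσ' : |σ| = 1 := by
    rw [← Real.sqrt_sq_eq_abs, hσ, Real.sqrt_one]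
  rw [← ofReal_norm, ← ofReal_norm, ← ENNReal.ofReal_pow (norm_nonneg _),
    ← ENNReal.ofReal_pow (norm_nonneg _), ← ENNReal.ofReal_mul (by positivity), Real.rpow_one,
    ← mul_pow]
  refine ENNReal.ofReal_le_ofReal ?_
  have h1 : ‖halfWaveDatum σ F G ξ‖ ≤ (‖F ξ‖ + ‖G ξ‖ / ‖ξ‖) / 2 := by
    rw [halfWaveDatum, norm_div]
    simp only [RCLike.norm_ofNat]
    gcongr
    refine (norm_sub_le _ _).trans (le_of_eq ?_)
    simp [hσ']
  have h2 : ‖G ξ‖ / ‖ξ‖ * ‖ξ‖ ≤ ‖G ξ‖ := by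
    rcases eq_or_ne ‖ξ‖ 0 with h | h
    · simp [h]
    · rw [div_mul_cancel₀ _ h]
  have h3 : ‖halfWaveDatum σ F G ξ‖ * ‖ξ‖ ≤ (‖F ξ‖ * ‖ξ‖ + ‖G ξ‖) / 2 := by
    have := mul_le_mul_of_nonneg_right h1 (norm_nonneg ξ)
    linarith
  have h4 := pow_le_pow_left₀ (by positivity) h3 2
  nlinarith [sq_nonneg (‖F ξ‖ * ‖ξ‖ - ‖G ξ‖), sq_nonneg (‖F ξ‖), sq_nonneg (‖F ξ‖ * ‖ξ‖),
    sq_nonneg ‖G ξ‖]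

theorem measurable_halfWaveDatum {n : ℕ} (σ : ℝ)
    (φ ψ : SchwartzMap (EuclideanSpace ℝ (Fin n)) ℂ) : Measurable (halfWaveDatum σ φ ψ) := by
  have h1 := φ.continuous.measurable
  have h2 := ψ.continuous.measurable
  unfold halfWaveDatum
  fun_prop

theorem integrable_halfWaveDatum {n : ℕ} (hn : 2 ≤ n) (σ : ℝ)
    (φ ψ : SchwartzMap (EuclideanSpace ℝ (Fin n)) ℂ) : Integrable (halfWaveDatum σ φ ψ) :=
  (φ.integrable.sub ((ψ.integrable_div_norm hn).const_mul _)).div_const 2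

theorem integrable_halfWavePhase_mul {n : ℕ} {h : EuclideanSpace ℝ (Fin n) → ℂ}
    (hh : Integrable h) (σ : ℝ) (z : ℝ × EuclideanSpace ℝ (Fin n)) :
    Integrable fun ξ ↦ halfWavePhase σ z ξ * h ξ :=
  hh.bdd_mul (c := 1) ((continuous_halfWavePhase σ).comp
    (Continuous.prodMk_right z)).aestronglyMeasurable
    (Filter.Eventually.of_forall fun ξ ↦ (norm_halfWavePhase σ z ξ).le)

theorem enorm_waveSol_sq_le {n : ℕ} (hn : 2 ≤ n)
    {f g φ ψ : SchwartzMap (EuclideanSpace ℝ (Fin n)) ℂ} (hφ : ⇑φ = fourierT ⇑f)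
    (hψ : ⇑ψ = fourierT ⇑g) (t : ℝ) (x : EuclideanSpace ℝ (Fin n)) :
    ‖waveSol f g t x‖ₑ ^ 2 ≤
      2 * (‖∫ ξ, halfWavePhase 1 (t, x) ξ * halfWaveDatum 1 φ ψ ξ‖ₑ ^ 2 +
        ‖∫ ξ, halfWavePhase (-1) (t, x) ξ * halfWaveDatum (-1) φ ψ ξ‖ₑ ^ 2) := by
  have hc0 : (0 : ℝ) ≤ (2 * Real.pi) ^ (-(n : ℝ) / 2) := by positivity
  have hc1 : ((2 * Real.pi) ^ (-(n : ℝ) / 2) : ℝ) ≤ 1 := by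
    refine Real.rpow_le_one_of_one_le_of_nonpos ?_ ?_
    · linarith [Real.pi_gt_three]
    · have : (0 : ℝ) ≤ n := n.cast_nonneg
      linarith
  rw [waveSol, ← hφ, ← hψ]
  simp_rw [wave_multiplier_eq_add_halfWave]
  rw [integral_add (integrable_halfWavePhase_mul (integrable_halfWaveDatum hn 1 φ ψ) _ _)
    (integrable_halfWavePhase_mul (integrable_halfWaveDatum hn (-1) φ ψ) _ _)]
  set a := ∫ ξ, halfWavePhase 1 (t, x) ξ * halfWaveDatum 1 φ ψ ξ
  set b := ∫ ξ, halfWavePhase (-1) (t, x) ξ * halfWaveDatum (-1) φ ψ ξ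
  rw [show (2 : ℝ≥0∞) = ENNReal.ofReal 2 by simp, ← ofReal_norm, ← ofReal_norm, ← ofReal_norm,
    ← ENNReal.ofReal_pow (norm_nonneg _), ← ENNReal.ofReal_pow (norm_nonneg _),
    ← ENNReal.ofReal_pow (norm_nonneg _), ← ENNReal.ofReal_add (by positivity) (by positivity),
    ← ENNReal.ofReal_mul (by positivity)]
  refine ENNReal.ofReal_le_ofReal ?_
  have h1 : ‖(((2 * Real.pi) ^ (-(n : ℝ) / 2) : ℝ) : ℂ) * (a + b)‖ ≤ ‖a‖ + ‖b‖ := by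
    rw [norm_mul, Complex.norm_real, Real.norm_of_nonneg hc0]
    exact (mul_le_of_le_one_left (norm_nonneg _) hc1).trans (norm_add_le a b)
  exact (pow_le_pow_left₀ (norm_nonneg _) h1 2).trans add_sq_le

theorem exists_enorm_integral_waveSol_le {n : ℕ} (hn : 4 ≤ n) :
    ∃ C : ℝ≥0∞, C ≠ ∞ ∧ ∀ f g : SchwartzMap (EuclideanSpace ℝ (Fin n)) ℂ,
      ‖∫ t : ℝ, ∫ x, ‖waveSol f g t x‖ ^ 2 / ‖x‖ ^ 3‖ₑ ≤
        C * ENNReal.ofReal (sobolevNormSq (1 : ℝ) (⇑f) + ∫ x, ‖g x‖ ^ 2) := by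
  obtain ⟨C, hC, hCle⟩ := exists_lintegral_halfWave_le hn
  refine ⟨2 * (C + C), ENNReal.mul_ne_top (by simp) (by simp [hC]), fun f g ↦ ?_⟩
  obtain ⟨φ, hφ, -⟩ := exists_schwartzMap_coe_eq_fourierT f
  obtain ⟨ψ, hψ, hψn⟩ := exists_schwartzMap_coe_eq_fourierT g
  set W : ℝ → ℝ × EuclideanSpace ℝ (Fin n) → ℝ≥0∞ := fun σ z ↦
    ‖∫ ξ, halfWavePhase σ z ξ * halfWaveDatum σ φ ψ ξ‖ₑ ^ 2 * ENNReal.ofReal ((‖z.2‖ ^ 3)⁻¹)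
    with hW
  have hWm : ∀ σ, Measurable (W σ) := by
    intro σ
    have := measurable_halfWave σ (measurable_halfWaveDatum σ φ ψ)
    fun_prop
  have hWadd : Measurable fun z ↦ W 1 z + W (-1) z := (hWm 1).add (hWm (-1))
  have hWle : ∀ σ : ℝ, σ ^ 2 = 1 → ∫⁻ z, W σ z ≤
      C * ENNReal.ofReal (sobolevNormSq (1 : ℝ) (⇑f) + ∫ x, ‖g x‖ ^ 2) := by
    intro σ hσ
    refine (hCle σ hσ _ (measurable_halfWaveDatum σ φ ψ)
      (integrable_halfWaveDatum (by omega) σ φ ψ)).trans (mul_le_mul_right ?_ C)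
    refine (lintegral_mono fun ξ ↦ enorm_halfWaveDatum_sq_mul_le hσ φ ψ ξ).trans (le_of_eq ?_)
    have hint : Integrable fun ξ ↦ (1 + ‖ξ‖ ^ 2) ^ (1 : ℝ) * ‖φ ξ‖ ^ 2 + ‖ψ ξ‖ ^ 2 :=
      φ.integrable_one_add_norm_sq_rpow_mul.add ψ.integrable_norm_sq
    rw [← ofReal_integral_eq_lintegral_ofReal hint
      (Filter.Eventually.of_forall fun ξ ↦ by positivity),
      integral_add φ.integrable_one_add_norm_sq_rpow_mul ψ.integrable_norm_sq, hψn,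
      sobolevNormSq, hφ]
  calc ‖∫ t : ℝ, ∫ x, ‖waveSol f g t x‖ ^ 2 / ‖x‖ ^ 3‖ₑ
      ≤ ∫⁻ t : ℝ, ∫⁻ x, ‖‖waveSol f g t x‖ ^ 2 / ‖x‖ ^ 3‖ₑ :=
        (enorm_integral_le_lintegral_enorm _).trans
          (lintegral_mono fun t ↦ enorm_integral_le_lintegral_enorm _)
    _ ≤ ∫⁻ t : ℝ, ∫⁻ x, 2 * (W 1 (t, x) + W (-1) (t, x)) := by
        refine lintegral_mono fun t ↦ lintegral_mono fun x ↦ ?_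
        rw [Real.enorm_of_nonneg (by positivity), div_eq_mul_inv,
          ENNReal.ofReal_mul (by positivity), ENNReal.ofReal_pow (norm_nonneg _), ofReal_norm]
        simp only [hW]
        rw [← add_mul, ← mul_assoc]
        exact mul_le_mul_left (enorm_waveSol_sq_le (by omega) hφ hψ t x) _
    _ = ∫⁻ z, 2 * (W 1 z + W (-1) z) := by
        rw [volume_eq_prod, lintegral_prod _ (hWadd.const_mul 2).aemeasurable]
    _ = 2 * ((∫⁻ z, W 1 z) + ∫⁻ z, W (-1) z) := by
        rw [lintegral_const_mul _ hWadd, lintegral_add_left (hWm 1)]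
    _ ≤ 2 * (C * ENNReal.ofReal (sobolevNormSq (1 : ℝ) (⇑f) + ∫ x, ‖g x‖ ^ 2) +
          C * ENNReal.ofReal (sobolevNormSq (1 : ℝ) (⇑f) + ∫ x, ‖g x‖ ^ 2)) :=
        mul_le_mul_right (add_le_add (hWle 1 (by norm_num)) (hWle (-1) (by norm_num))) 2
    _ = _ := by ring

end

/-- **Morawetz estimate for the wave equation** in dimension `n ≥ 4`: there is a
constant `C = C(n)` such that for all Schwartz Cauchy data `f, g`, the solution `u`
satisfies the global spacetime estimate
`∫_ℝ ∫ |u(t,x)|²/|x|³ dx dt ≤ C (‖f‖²_{H¹} + ‖g‖²_{L²})`. -/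
theorem wave_morawetz_estimate (n : ℕ) (hn : 4 ≤ n) :
    ∃ C : ℝ, ∀ f g : SchwartzMap (EuclideanSpace ℝ (Fin n)) ℂ,
      (∫ t : ℝ, ∫ x, ‖waveSol f g t x‖ ^ 2 / ‖x‖ ^ 3)
        ≤ C * (sobolevNormSq (1 : ℝ) (⇑f) + ∫ x, ‖g x‖ ^ 2) := by
  obtain ⟨C, hC, hCle⟩ := exists_enorm_integral_waveSol_le hn
  refine ⟨C.toReal, fun f g ↦ ?_⟩
  have h0 : 0 ≤ sobolevNormSq (1 : ℝ) (⇑f) + ∫ x, ‖g x‖ ^ 2 :=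
    add_nonneg (integral_nonneg fun ξ ↦ by positivity) (integral_nonneg fun x ↦ by positivity)
  have h1 := hCle f g
  rw [← ENNReal.ofReal_toReal hC, ← ENNReal.ofReal_mul ENNReal.toReal_nonneg, ← ofReal_norm,
    ENNReal.ofReal_le_ofReal_iff (mul_nonneg ENNReal.toReal_nonneg h0)] at h1
  exact (le_abs_self _).trans h1
end

section
/- Let n ≥ 1 be an integer, let (λ_j)_{j ∈ ℕ} be a nondecreasing sequence of nonnegative reals with λ_j → ∞, and let N(λ) = #{ j : λ_j ≤ λ } denote its counting function. Let ρ ∈ 𝒮(ℝ) be real-valued with ρ(λ) > 0 for all λ, and suppose there is A > 0 such that Σ_j ρ(λ − λ_j) ≤ A (1 + |λ|)^{n−1} for every λ ∈ ℝ. Then there is a constant C such that |N(λ + τ) − N(λ)| ≤ C (1 + |τ|)ⁿ (1 + |λ|)^{n−1} for all λ, τ ∈ ℝ. -/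
open Filter

/-- The counting function `N(μ) = #{ j : λ_j ≤ μ }` of a sequence `l : ℕ → ℝ`. -/
noncomputable def countingFun (l : ℕ → ℝ) (μ : ℝ) : ℕ :=
  Nat.card {j : ℕ | l j ≤ μ}

theorem finite_setOf_le_of_tendsto_atTop {l : ℕ → ℝ} (htop : Tendsto l atTop atTop) (x : ℝ) :
    {j : ℕ | l j ≤ x}.Finite := by
  have h : ∀ᶠ j in cofinite, x < l j := Nat.cofinite_eq_atTop ▸ htop.eventually_gt_atTop x
  simpa [Filter.eventually_cofinite] using h

theorem countingFun_mono {l : ℕ → ℝ} (htop : Tendsto l atTop atTop) :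
    Monotone (countingFun l) := fun _ y hxy =>
  Nat.card_mono (finite_setOf_le_of_tendsto_atTop htop y) fun _ hj => le_trans hj hxy

/-- A sum `∑ j, ρ (x - l j)` with `ρ ≥ c` on `[0, 1]` controls the number of `l j` in
`(x - 1, x]`. -/
theorem countingFun_unit_step {l : ℕ → ℝ} (htop : Tendsto l atTop atTop) {ρ : ℝ → ℝ} {c : ℝ}
    (hc : 0 < c) (hρ : ∀ t ∈ Set.Icc (0 : ℝ) 1, c ≤ ρ t) {x M : ℝ} (hM : 0 ≤ M)
    (hsum : (∑' j : ℕ, ENNReal.ofReal (ρ (x - l j))) ≤ ENNReal.ofReal M) :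
    (countingFun l x : ℝ) ≤ countingFun l (x - 1) + M / c := by
  classical
  have hfin := finite_setOf_le_of_tendsto_atTop htop
  have hcard : ∀ y, countingFun l y = (hfin y).toFinset.card := fun y =>
    Nat.card_eq_card_finite_toFinset (hfin y)
  set D := (hfin x).toFinset \ (hfin (x - 1)).toFinset with hD
  have hle : (countingFun l x : ℝ) ≤ countingFun l (x - 1) + D.card := by
    rw [hcard, hcard]
    exact_mod_cast Finset.card_le_card_sdiff_add_card.trans_eq (add_comm _ _)
  have hDle : ENNReal.ofReal (D.card * c) ≤ ENNReal.ofReal M := by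
    calc ENNReal.ofReal (D.card * c) = ∑ _j ∈ D, ENNReal.ofReal c := by
          rw [Finset.sum_const, nsmul_eq_mul, ENNReal.ofReal_mul (by positivity),
            ENNReal.ofReal_natCast]
      _ ≤ ∑ j ∈ D, ENNReal.ofReal (ρ (x - l j)) := by
          refine Finset.sum_le_sum fun j hj => ENNReal.ofReal_le_ofReal (hρ _ ?_)
          simp only [hD, Finset.mem_sdiff, Set.Finite.mem_toFinset, Set.mem_ofPred_eq,
            not_le] at hj
          exact ⟨by linarith [hj.1], by linarith [hj.2]⟩
      _ ≤ _ := ENNReal.sum_le_tsum D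
      _ ≤ _ := hsum
  have hDM : (D.card : ℝ) ≤ M / c :=
    (le_div_iff₀ hc).2 ((ENNReal.ofReal_le_ofReal_iff hM).1 hDle)
  linarith

theorem le_add_nat_mul_of_unit_step {f : ℝ → ℝ} {K : ℝ} (hK : 0 ≤ K) {d : ℕ}
    (hf : ∀ x, f x ≤ f (x - 1) + K * (1 + |x|) ^ d) (a B : ℝ) (m : ℕ)
    (hB : 1 + |a| + m ≤ B) : f (a + m) ≤ f a + m * (K * B ^ d) := by
  induction m with
  | zero => simp
  | succ k ih =>
    push_cast at hB ⊢
    have h1 := ih (by linarith)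
    have h2 := hf (a + (k + 1))
    rw [show a + ((k : ℝ) + 1) - 1 = a + k by ring] at h2
    have h3 : |a + ((k : ℝ) + 1)| ≤ |a| + (k + 1) :=
      (abs_add_le _ _).trans_eq (by rw [abs_of_nonneg (a := (k : ℝ) + 1) (by positivity)])
    have h4 : K * (1 + |a + ((k : ℝ) + 1)|) ^ d ≤ K * B ^ d := by
      gcongr
      linarith
    linarith

/-- If `(λ_j)` is a nondecreasing sequence of nonnegative reals tending to `∞`, `ρ` is a
strictly positive real-valued Schwartz function, and `Σ_j ρ(λ − λ_j) ≤ A (1+|λ|)^{n−1}`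
for all `λ`, then `|N(λ+τ) − N(λ)| ≤ C (1+|τ|)ⁿ (1+|λ|)^{n−1}` for all `λ, τ`. -/
theorem counting_shift_bound (n : ℕ) (hn : 1 ≤ n)
    (l : ℕ → ℝ) (hmono : Monotone l) (hpos : ∀ j, 0 ≤ l j)
    (htop : Tendsto l atTop atTop)
    (ρ : SchwartzMap ℝ ℝ) (hρpos : ∀ x : ℝ, 0 < ρ x)
    (A : ℝ) (hA : 0 < A)
    (hsum : ∀ μ : ℝ, (∑' j : ℕ, ENNReal.ofReal (ρ (μ - l j)))
      ≤ ENNReal.ofReal (A * (1 + |μ|) ^ (n - 1))) :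
    ∃ C : ℝ, ∀ μ τ : ℝ,
      |(countingFun l (μ + τ) : ℝ) - (countingFun l μ : ℝ)|
        ≤ C * (1 + |τ|) ^ n * (1 + |μ|) ^ (n - 1) := by
  obtain ⟨t₀, -, ht₀⟩ := isCompact_Icc.exists_isMinOn (Set.nonempty_Icc.2 zero_le_one)
    (ρ.continuous.continuousOn (s := Set.Icc (0 : ℝ) 1))
  set K := A / ρ t₀ with hKdef
  have hK : 0 ≤ K := (div_pos hA (hρpos t₀)).le
  have hstep : ∀ x : ℝ, (countingFun l x : ℝ)
      ≤ countingFun l (x - 1) + K * (1 + |x|) ^ (n - 1) := fun x => by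
    have h := countingFun_unit_step htop (hρpos t₀) (fun t ht => ht₀ ht)
      (by positivity) (hsum x)
    rwa [mul_div_right_comm] at h
  have hN := countingFun_mono htop
  refine ⟨K * 2 ^ (n - 1), fun μ τ => ?_⟩
  have hbound : ∀ a b : ℝ, |a| ≤ |μ| + |τ| → b - a ≤ |τ| →
      (countingFun l b : ℝ) - countingFun l a
        ≤ K * 2 ^ (n - 1) * (1 + |τ|) ^ n * (1 + |μ|) ^ (n - 1) := fun a b ha hb => by
    have hm : (⌈|τ|⌉₊ : ℝ) ≤ 1 + |τ| := by linarith [Nat.ceil_lt_add_one (abs_nonneg τ)]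
    have hB : 1 + |a| + (⌈|τ|⌉₊ : ℝ) ≤ 2 * (1 + |τ|) * (1 + |μ|) := by
      nlinarith [abs_nonneg μ, mul_nonneg (abs_nonneg τ) (abs_nonneg μ)]
    have h1 := le_add_nat_mul_of_unit_step (f := fun x => (countingFun l x : ℝ)) hK hstep a _ _ hB
    have h2 : (countingFun l b : ℝ) ≤ countingFun l (a + ⌈|τ|⌉₊) :=
      Nat.cast_le.2 (hN (by linarith [Nat.le_ceil |τ|]))
    calc (countingFun l b : ℝ) - countingFun l a
        ≤ ⌈|τ|⌉₊ * (K * (2 * (1 + |τ|) * (1 + |μ|)) ^ (n - 1)) := by linarith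
      _ ≤ (1 + |τ|) * (K * (2 * (1 + |τ|) * (1 + |μ|)) ^ (n - 1)) := by gcongr
      _ = _ := by
        obtain ⟨d, rfl⟩ := Nat.exists_eq_add_of_le' hn
        simp only [Nat.add_sub_cancel, mul_pow, pow_succ]
        ring
  rw [abs_sub_le_iff]
  exact ⟨hbound μ (μ + τ) (by linarith [abs_nonneg τ]) (by linarith [le_abs_self τ]),
    hbound (μ + τ) μ (abs_add_le _ _) (by linarith [neg_le_abs τ])⟩
end
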